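/- Let (S, Σ) be a measurable space, let κ be a Markov kernel from S to S, let γ be a real number with 0 < γ < 1, and fix s ∈ S. Define the iterates κ⁰(s, ·) = δ_s (the Dirac measure at s) and κ^{k+1}(s, ·) = (κ^k(s, ·)).bind κ. Then the discounted visitation measure ν_s = (1 − γ)·Σ_{k=0}^{∞} γ^k · κ^k(s, ·) is a probability measure on S and satisfies the fixed-point identity ν_s = (1 − γ)·δ_s + γ·(ν_s.bind κ). -/

import Mathlib

open MeasureTheory ProbabilityTheory

/-- Iterates of a Markov kernel: `kernelIter κ 0 s = δ_s` and
`kernelIter κ (k+1) s = (kernelIter κ k s).bind κ`. -/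
noncomputable def kernelIter {S : Type*} [MeasurableSpace S]
    (κ : Kernel S S) : ℕ → S → Measure S
  | 0, s => Measure.dirac s
  | k + 1, s => (kernelIter κ k s).bind (fun x => κ x)

instance kernelIter.isProbabilityMeasure {S : Type*} [MeasurableSpace S]
    (κ : Kernel S S) [IsMarkovKernel κ] (k : ℕ) (s : S) :
    IsProbabilityMeasure (kernelIter κ k s) := by
  induction k with
  | zero => exact Measure.dirac.isProbabilityMeasure
  | succ k ih =>
    refine ⟨?_⟩
    rw [kernelIter, Measure.bind_apply .univ κ.measurable.aemeasurable]
    simp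

/-- A sum of measures indexed by `ℕ` splits into its first term and the sum of the rest. -/
theorem MeasureTheory.Measure.sum_nat_eq_zero_add {S : Type*} [MeasurableSpace S]
    (μ : ℕ → Measure S) :
    Measure.sum μ = μ 0 + Measure.sum fun k => μ (k + 1) := by
  ext t ht
  rw [Measure.add_apply, Measure.sum_apply _ ht, Measure.sum_apply _ ht,
    tsum_eq_zero_add' ENNReal.summable]

theorem tsum_ofReal_geometric_weight {γ : ℝ} (hγ0 : 0 ≤ γ) (hγ1 : γ < 1) :
    ∑' k : ℕ, ENNReal.ofReal ((1 - γ) * γ ^ k) = 1 := by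
  rw [← ENNReal.ofReal_tsum_of_nonneg
      (fun k => mul_nonneg (sub_nonneg.2 hγ1.le) (pow_nonneg hγ0 k))
      ((summable_geometric_of_lt_one hγ0 hγ1).mul_left _),
    tsum_mul_left, tsum_geometric_of_lt_one hγ0 hγ1,
    mul_inv_cancel₀ (sub_pos.2 hγ1).ne', ENNReal.ofReal_one]

theorem stmt_5 {S : Type*} [MeasurableSpace S]
    (κ : Kernel S S) [IsMarkovKernel κ]
    (γ : ℝ) (hγ0 : 0 < γ) (hγ1 : γ < 1) (s : S)
    (ν : Measure S)
    (hν : ν = Measure.sum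
      (fun k : ℕ => (ENNReal.ofReal ((1 - γ) * γ ^ k)) • kernelIter κ k s)) :
    IsProbabilityMeasure ν ∧
      ν = ENNReal.ofReal (1 - γ) • Measure.dirac s +
        ENNReal.ofReal γ • ν.bind (fun x => κ x) := by
  subst hν
  constructor
  · refine ⟨?_⟩
    rw [Measure.sum_apply _ .univ]
    simpa using tsum_ofReal_geometric_weight hγ0.le hγ1
  · rw [Measure.bind_sum _ _ κ.measurable.aemeasurable]
    conv_lhs => rw [Measure.sum_nat_eq_zero_add]
    congr 1
    · simp [kernelIter]
    · ext t ht
      rw [Measure.smul_apply, Measure.sum_apply _ ht, Measure.sum_apply _ ht, smul_eq_mul,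
        ← ENNReal.tsum_mul_left]
      refine tsum_congr fun k => ?_
      rw [Measure.bind_smul, Measure.smul_apply, Measure.smul_apply, smul_eq_mul, smul_eq_mul,
        ← mul_assoc, ← ENNReal.ofReal_mul hγ0.le, kernelIter, pow_succ',
        mul_left_comm (1 - γ)]
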